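/- Let Σ ∈ ℝ^{d×d} be nonnegative definite with σ_i² = Σ_{ii}, let Z ~ N_d(0,Σ), let P(w) = A + B∑_{i=1}^d |w_i|^r with A, B ≥ 0 and r ≥ 0, let t ≥ 1, h ∈ C_b^t(ℝ^m) and g ∈ C_P^{t,m}(ℝ^d), and let f be the solution of the multivariate normal Stein equation ∇ᵀΣ∇f(w) − wᵀ∇f(w) = h(g(w)) − E[h(g(Z))] given by f(w) = −∫_0^∞ { E[h(g(e^{−s}w + √(1−e^{−2s}) Z))] − E[h(g(Z))] } ds. Then, for every w ∈ ℝ^d and all indices i_1,…,i_t, |∂^t f(w)/∂w_{i_1}⋯∂w_{i_t}| ≤ (h_{t,m}/t) [ A + ∑_{i=1}^d 2^{r/2} B ( |w_i|^r + μ_{r,σ_i} ) ]. -/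

import Mathlib

open MeasureTheory ProbabilityTheory Real

noncomputable section

/-- `μ_{r,σ}`: the `r`-th absolute moment of the normal distribution `N(0, σ²)`. -/
def absMoment (r σ : ℝ) : ℝ :=
  2 ^ (r / 2) * σ ^ r * Real.Gamma ((r + 1) / 2) / Real.sqrt π

/-- Stirling numbers of the second kind. -/
def stirling2 : ℕ → ℕ → ℕ
  | 0, 0 => 1
  | 0, _ + 1 => 0
  | _ + 1, 0 => 0
  | n + 1, k + 1 => (k + 1) * stirling2 n (k + 1) + stirling2 n k

/-- The partial derivative `∂^k f / (∂w_{idx 0} ⋯ ∂w_{idx (k-1)})` of `f : ℝ^d → ℝ` at `w`. -/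
def pderiv' {d : ℕ} (k : ℕ) (f : (Fin d → ℝ) → ℝ) (w : Fin d → ℝ) (idx : Fin k → Fin d) : ℝ :=
  iteratedFDeriv ℝ k f w (fun j => Pi.single (idx j) 1)

/-- `|h|_k`: the supremum over all points and all index tuples of the absolute `k`-th order
partial derivatives of `h : ℝ^m → ℝ`. -/
def hknorm {m : ℕ} (k : ℕ) (h : (Fin m → ℝ) → ℝ) : ℝ :=
  ⨆ p : (Fin m → ℝ) × (Fin k → Fin m), |pderiv' k h p.1 p.2|

/-- `h_{p,m} = ∑_{k=1}^p m^k S(p,k) |h|_k`. -/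
def hpm (m p : ℕ) (h : (Fin m → ℝ) → ℝ) : ℝ :=
  ∑ k ∈ Finset.Icc 1 p, (m : ℝ) ^ k * (stirling2 p k : ℝ) * hknorm k h

/-- The class `C_b^p(ℝ^m)` of functions with bounded partial derivatives up to order `p`. -/
def CbP (m p : ℕ) (h : (Fin m → ℝ) → ℝ) : Prop :=
  ContDiff ℝ p h ∧
    ∀ k ≤ p, ∃ C, ∀ (w : Fin m → ℝ) (idx : Fin k → Fin m), |pderiv' k h w idx| ≤ C

/-- The class `𝒞_P^{t,nn,m}(ℝ^d)` with `P_k(w) = A_{t+k} (1 + ∑_i |w_i|^{r_{t+k}})`. -/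
def ClassCP (d m t nn : ℕ) (A r : ℕ → ℝ) (f : (Fin d → ℝ) → Fin m → ℝ) : Prop :=
  ContDiff ℝ (t + nn) f ∧
    ∀ k ≤ nn, ∀ (l : Fin m) (w : Fin d → ℝ) (idx : Fin (t + k) → Fin d),
      |pderiv' (t + k) (fun v => f v l) w idx| ≤ A (t + k) * (1 + ∑ i, |w i| ^ r (t + k))

/-- The class `C_P^{t,m}(ℝ^d)` for a dominating function `P`. -/
def ClassCPmulti (d m t : ℕ) (P : (Fin d → ℝ) → ℝ) (g : (Fin d → ℝ) → Fin m → ℝ) : Prop :=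
  ContDiff ℝ t g ∧
    ∀ k, 1 ≤ k → k ≤ t → ∀ (l : Fin m) (w : Fin d → ℝ) (idx : Fin k → Fin d),
      |pderiv' k (fun v => g v l) w idx| ^ ((t : ℝ) / k) ≤ P w

/-- The class `𝒞_P^{t,nn,1}(ℝ)` with `P_k(w) = A_{t+k} (1 + |w|^{r_{t+k}})`. -/
def ClassCPuni (t nn : ℕ) (A r : ℕ → ℝ) (f : ℝ → ℝ) : Prop :=
  ContDiff ℝ (t + nn) f ∧
    ∀ k ≤ nn, ∀ w : ℝ, |iteratedDeriv (t + k) f w| ≤ A (t + k) * (1 + |w| ^ r (t + k))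

/-- The class `C_P^{t,1}(ℝ)` for a dominating function `P`. -/
def ClassCPuniGen (t : ℕ) (P : ℝ → ℝ) (g : ℝ → ℝ) : Prop :=
  ContDiff ℝ t g ∧ ∀ k, 1 ≤ k → k ≤ t → ∀ w : ℝ, |iteratedDeriv k g w| ^ ((t : ℝ) / k) ≤ P w

/-- The class `C_b^p(ℝ)` of functions with bounded derivatives up to order `p`. -/
def Cb1 (p : ℕ) (h : ℝ → ℝ) : Prop :=
  ContDiff ℝ p h ∧ ∀ k ≤ p, ∃ C, ∀ w : ℝ, |iteratedDeriv k h w| ≤ C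

/-- Sup-norm of a real function. -/
def supNorm (h : ℝ → ℝ) : ℝ := ⨆ w, |h w|

/-- `Z` is a centred `d`-dimensional Gaussian vector with covariance matrix `S`. -/
def IsGaussianVec {Ω : Type*} [MeasureSpace Ω] {d : ℕ} (Z : Ω → Fin d → ℝ)
    (S : Matrix (Fin d) (Fin d) ℝ) : Prop :=
  Measurable Z ∧ ∀ l : Fin d → ℝ,
    Measure.map (fun ω => ∑ j, l j * Z ω j) ℙ =
      gaussianReal 0 (∑ j, ∑ k, l j * S j k * l k).toNNReal

/-- `a_{n,d,r} = max(d/n^{r/2}, 1)`. -/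
def aConst (n d : ℕ) (r : ℝ) : ℝ := max ((d : ℝ) / (n : ℝ) ^ (r / 2)) 1

def alphaC (r : ℝ) : ℝ := if r ≤ 1 then 4 else r + 3
def betaC (r : ℝ) : ℝ := if r ≤ 1 then 4 else r + 5
def gammaC (r σ : ℝ) : ℝ :=
  if r ≤ 1 then 2 * absMoment r σ else σ⁻¹ * (r + 1) * absMoment (r + 1) σ
def alphaT (r : ℝ) : ℝ := if r ≤ 1 then 10 else r ^ 2 + r + 8
def betaT (r : ℝ) : ℝ := if r ≤ 1 then 10 else r ^ 2 + 2 * r + 18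
def gammaT (r σ : ℝ) : ℝ :=
  if r ≤ 1 then 10 * absMoment (r + 1) σ else σ⁻¹ * (2 * r ^ 2 + r + 5) * absMoment (r + 1) σ

theorem OrderedFinpartition.sum_length_succ (n : ℕ) (φ : ℕ → ℕ) :
    ∑ c : OrderedFinpartition (n + 1), φ c.length =
      ∑ c : OrderedFinpartition n, (φ (c.length + 1) + c.length * φ c.length) := by
  rw [← (OrderedFinpartition.extendEquiv n).sum_comp, Fintype.sum_sigma]
  refine Finset.sum_congr rfl fun c _ => ?_
  simp [Fintype.sum_option]

theorem OrderedFinpartition.sum_length_eq_ite (n k : ℕ) :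
    ∑ c : OrderedFinpartition n, (if c.length = k then 1 else 0) = stirling2 n k := by
  induction n generalizing k with
  | zero =>
    rw [Fintype.sum_unique, OrderedFinpartition.default_eq]
    cases k <;> simp [stirling2, OrderedFinpartition.atomic]
  | succ n ih =>
    rw [OrderedFinpartition.sum_length_succ n fun l => if l = k then 1 else 0]
    cases k with
    | zero => simp [stirling2]
    | succ k =>
      rw [stirling2, ← ih, ← ih, Finset.sum_add_distrib, Finset.mul_sum, add_comm]
      simp only [Nat.add_right_cancel_iff]
      refine Finset.sum_congr rfl fun c _ => ?_
      split_ifs with h <;> simp [h]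

theorem OrderedFinpartition.sum_length {n : ℕ} (hn : 1 ≤ n) (φ : ℕ → ℝ) :
    ∑ c : OrderedFinpartition n, φ c.length =
      ∑ k ∈ Finset.Icc 1 n, (stirling2 n k : ℝ) * φ k := by
  have key : ∀ c : OrderedFinpartition n,
      φ c.length = ∑ k ∈ Finset.Icc 1 n, (if c.length = k then (1 : ℝ) else 0) * φ k := by
    intro c
    simp [c.length_le, Nat.succ_le_of_lt (c.length_pos hn)]
  simp_rw [key]
  rw [Finset.sum_comm]
  refine Finset.sum_congr rfl fun k _ => ?_
  rw [← Finset.sum_mul, ← OrderedFinpartition.sum_length_eq_ite]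
  push_cast
  rfl

theorem OrderedFinpartition.sum_partSize {n : ℕ} (c : OrderedFinpartition n) :
    ∑ i, c.partSize i = n := by
  simpa using Fintype.card_congr c.equivSigma

/-- A multilinear form on a space of tuples, expanded in the standard basis. -/
theorem MultilinearMap.apply_eq_sum_single {m k : ℕ}
    (M : MultilinearMap ℝ (fun _ : Fin k => Fin m → ℝ) ℝ) (y : Fin k → Fin m → ℝ) :
    M y = ∑ l : Fin k → Fin m, (∏ j, y j (l j)) * M fun j => Pi.single (l j) 1 := by
  have hy : y = fun j => ∑ l : Fin m, y j l • (Pi.single l 1 : Fin m → ℝ) := by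
    ext j
    simp [Finset.sum_apply, Pi.single_apply]
  conv_lhs => rw [hy]
  rw [M.map_sum]
  refine Finset.sum_congr rfl fun l _ => ?_
  rw [M.map_smul_univ, smul_eq_mul]

theorem norm_le_sum_abs_apply_single {d k : ℕ}
    (M : ContinuousMultilinearMap ℝ (fun _ : Fin k => Fin d → ℝ) ℝ) :
    ‖M‖ ≤ ∑ l : Fin k → Fin d, |M fun j => Pi.single (l j) 1| := by
  refine M.opNorm_le_bound (by positivity) fun v => ?_
  have := MultilinearMap.apply_eq_sum_single M.toMultilinearMap v
  rw [ContinuousMultilinearMap.coe_coe] at this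
  rw [this, Finset.sum_mul]
  refine (norm_sum_le _ _).trans (Finset.sum_le_sum fun l _ => ?_)
  rw [norm_mul, mul_comm, norm_prod]
  refine mul_le_mul_of_nonneg_left ?_ (abs_nonneg _)
  exact Finset.prod_le_prod (fun _ _ => norm_nonneg _) fun j _ => norm_le_pi_norm (v j) (l j)

theorem norm_iteratedFDeriv_le_sum_pderiv {d k : ℕ} (f : (Fin d → ℝ) → ℝ) (w : Fin d → ℝ) :
    ‖iteratedFDeriv ℝ k f w‖ ≤ ∑ l : Fin k → Fin d, |pderiv' k f w l| :=
  norm_le_sum_abs_apply_single _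

theorem CbP.bddAbove {m p k : ℕ} {h : (Fin m → ℝ) → ℝ} (hh : CbP m p h) (hk : k ≤ p) :
    BddAbove (Set.range fun q : (Fin m → ℝ) × (Fin k → Fin m) => |pderiv' k h q.1 q.2|) := by
  obtain ⟨C, hC⟩ := hh.2 k hk
  exact ⟨C, by rintro _ ⟨q, rfl⟩; exact hC _ _⟩

theorem hknorm_nonneg {m : ℕ} (k : ℕ) (h : (Fin m → ℝ) → ℝ) : 0 ≤ hknorm k h :=
  Real.iSup_nonneg fun _ => abs_nonneg _

theorem hpm_nonneg (m p : ℕ) (h : (Fin m → ℝ) → ℝ) : 0 ≤ hpm m p h :=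
  Finset.sum_nonneg fun k _ => mul_nonneg (by positivity) (hknorm_nonneg k h)

theorem iteratedFDeriv_coord_apply {d m k : ℕ} {g : (Fin d → ℝ) → Fin m → ℝ}
    (hg : ContDiff ℝ k g) (x : Fin d → ℝ) (v : Fin k → Fin d → ℝ) (l : Fin m) :
    iteratedFDeriv ℝ k g x v l = iteratedFDeriv ℝ k (fun y => g y l) x v := by
  have := (ContinuousLinearMap.proj (R := ℝ) (φ := fun _ : Fin m => ℝ) l).iteratedFDeriv_comp_left
    (f := g) (x := x) hg.contDiffAt (i := k) le_rfl
  exact (congrArg (fun M => M v) this).symm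

/-- A consequence of Faà di Bruno's formula. -/
theorem abs_pderiv_comp_le {d m k : ℕ} (hk : 1 ≤ k) {h : (Fin m → ℝ) → ℝ} (hh : CbP m k h)
    {g : (Fin d → ℝ) → Fin m → ℝ} (hg : ContDiff ℝ k g) {x : Fin d → ℝ} {Q : ℝ}
    (hQ : ∀ j, 1 ≤ j → j ≤ k → ∀ (l : Fin m) (idx : Fin j → Fin d),
      |pderiv' j (fun v => g v l) x idx| ≤ Q ^ j) (idx : Fin k → Fin d) :
    |pderiv' k (fun v => h (g v)) x idx| ≤ hpm m k h * Q ^ k := by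
  have hcomp := iteratedFDeriv_comp (𝕜 := ℝ) (x := x) (g := h) (f := g)
    hh.1.contDiffAt hg.contDiffAt (i := k) le_rfl
  have hterm : ∀ c : OrderedFinpartition k,
      |((ftaylorSeries ℝ h (g x)).compAlongOrderedFinpartition (ftaylorSeries ℝ g x) c)
        fun j => Pi.single (idx j) 1| ≤ (m : ℝ) ^ c.length * hknorm c.length h * Q ^ k := by
    intro c
    rw [FormalMultilinearSeries.compAlongOrderedFinpartition_apply]
    have hexp := MultilinearMap.apply_eq_sum_single
      (iteratedFDeriv ℝ c.length h (g x)).toMultilinearMap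
      (c.applyOrderedFinpartition (fun i => ftaylorSeries ℝ g x (c.partSize i))
        fun j => Pi.single (idx j) 1)
    rw [ContinuousMultilinearMap.coe_coe] at hexp
    change |iteratedFDeriv ℝ c.length h (g x) _| ≤ _
    rw [hexp]
    have hcard : (m : ℝ) ^ c.length * hknorm c.length h * Q ^ k
        = ∑ _l : Fin c.length → Fin m, Q ^ k * hknorm c.length h := by
      simp
      ring
    rw [hcard]
    refine (Finset.abs_sum_le_sum_abs _ _).trans (Finset.sum_le_sum fun l _ => ?_)
    have hprod : |∏ i, c.applyOrderedFinpartition (fun i => ftaylorSeries ℝ g x (c.partSize i))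
        (fun j => Pi.single (idx j) 1) i (l i)| ≤ Q ^ k := by
      rw [Finset.abs_prod]
      calc _ ≤ ∏ i, Q ^ c.partSize i := by
            refine Finset.prod_le_prod (fun _ _ => abs_nonneg _) fun i _ => ?_
            have hle := c.partSize_le i
            have hgi : ContDiff ℝ (c.partSize i) g := hg.of_le (by exact_mod_cast hle)
            refine le_of_eq_of_le ?_ (hQ _ (c.partSize_pos i) hle (l i) (idx ∘ c.emb i))
            rw [OrderedFinpartition.applyOrderedFinpartition_apply]
            exact congrArg _ (iteratedFDeriv_coord_apply hgi x _ (l i))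
        _ = Q ^ k := by rw [Finset.prod_pow_eq_pow_sum, c.sum_partSize]
    rw [abs_mul]
    refine mul_le_mul hprod ?_ (abs_nonneg _) ((abs_nonneg _).trans hprod)
    exact le_ciSup (hh.bddAbove c.length_le) (g x, l)
  have heq : pderiv' k (fun v => h (g v)) x idx = ∑ c : OrderedFinpartition k,
      ((ftaylorSeries ℝ h (g x)).compAlongOrderedFinpartition (ftaylorSeries ℝ g x) c)
        fun j => Pi.single (idx j) 1 := by
    rw [pderiv', show (fun v => h (g v)) = h ∘ g from rfl, hcomp]
    simp [FormalMultilinearSeries.taylorComp]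
  rw [heq]
  refine (Finset.abs_sum_le_sum_abs _ _).trans ((Finset.sum_le_sum fun c _ => hterm c).trans ?_)
  rw [← Finset.sum_mul, OrderedFinpartition.sum_length hk fun l => (m : ℝ) ^ l * hknorm l h, hpm]
  refine le_of_eq (congrArg (· * Q ^ k) (Finset.sum_congr rfl fun j _ => by ring))

theorem fderiv_integral_apply_of_dominated {α E V : Type*} [MeasurableSpace α] {μ : Measure α}
    [NormedAddCommGroup E] [NormedSpace ℝ E] [NormedAddCommGroup V] [NormedSpace ℝ V]
    {G : α → E → V} {x : E} {b : α → ℝ} (hG : ∀ a, Differentiable ℝ (G a))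
    (hmeas : ∀ y, AEStronglyMeasurable (fun a => G a y) μ) (hint : Integrable (fun a => G a x) μ)
    (hmeas' : AEStronglyMeasurable (fun a => fderiv ℝ (G a) x) μ) (hb : Integrable b μ)
    (hle : ∀ᵐ a ∂μ, ∀ y, ‖y‖ ≤ ‖x‖ + 1 → ‖fderiv ℝ (G a) y‖ ≤ b a) :
    (∀ v, Integrable (fun a => fderiv ℝ (G a) x v) μ) ∧
      ∀ v, fderiv ℝ (fun y => ∫ a, G a y ∂μ) x v = ∫ a, fderiv ℝ (G a) x v ∂μ := by
  have hi : Integrable (fun a => fderiv ℝ (G a) x) μ :=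
    hb.mono' hmeas' (hle.mono fun a ha => ha x (by linarith))
  have hd : HasFDerivAt (fun x => ∫ a, G a x ∂μ) (∫ a, fderiv ℝ (G a) x ∂μ) x := by
    refine hasFDerivAt_integral_of_dominated_of_fderiv_le
      (F := fun y a => G a y) (F' := fun y a => fderiv ℝ (G a) y) (bound := b)
      (Metric.ball_mem_nhds x one_pos) (.of_forall hmeas) hint hmeas'
      (hle.mono fun a ha y hy => ha y ?_) hb (.of_forall fun a y _ => (hG a y).hasFDerivAt)
    have : ‖y‖ ≤ ‖x‖ + ‖y - x‖ := by simpa using norm_add_le x (y - x)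
    rw [Metric.mem_ball, dist_eq_norm] at hy
    linarith
  refine ⟨hi.apply_continuousLinearMap, fun v => ?_⟩
  rw [hd.fderiv, ContinuousLinearMap.integral_apply hi]

/-- Iterated differentiation under the integral sign. -/
theorem iteratedFDeriv_integral_of_dominated {α E : Type*} [MeasurableSpace α] {μ : Measure α}
    [NormedAddCommGroup E] [NormedSpace ℝ E] {n : ℕ} {F : α → E → ℝ}
    (hF : ∀ a, ContDiff ℝ n (F a))
    (hmeas : ∀ k ≤ n, ∀ x, AEStronglyMeasurable (fun a => iteratedFDeriv ℝ k (F a) x) μ)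
    (hbound : ∀ k ≤ n, ∀ R : ℝ, ∃ b : α → ℝ, Integrable b μ ∧
      ∀ᵐ a ∂μ, ∀ x, ‖x‖ ≤ R → ‖iteratedFDeriv ℝ k (F a) x‖ ≤ b a)
    {k : ℕ} (hk : k ≤ n) :
    iteratedFDeriv ℝ k (fun x => ∫ a, F a x ∂μ) = fun x => ∫ a, iteratedFDeriv ℝ k (F a) x ∂μ := by
  have hint : ∀ k ≤ n, ∀ x, Integrable (fun a => iteratedFDeriv ℝ k (F a) x) μ := by
    intro k hk x
    obtain ⟨b, hb, hle⟩ := hbound k hk ‖x‖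
    exact hb.mono' (hmeas k hk x) (hle.mono fun a ha => ha x le_rfl)
  induction k with
  | zero =>
    ext x v
    rw [iteratedFDeriv_zero_apply]
    have := (ContinuousMultilinearMap.apply ℝ (fun _ : Fin 0 => E) ℝ v).integral_comp_comm
      (hint 0 hk x)
    simpa using this
  | succ k ih =>
    rw [iteratedFDeriv_succ_eq_comp_left, ih (by omega)]
    ext1 x
    obtain ⟨b, hb, hle⟩ := hbound (k + 1) hk (‖x‖ + 1)
    have hmeas' : AEStronglyMeasurable
        (fun a => fderiv ℝ (iteratedFDeriv ℝ k (F a)) x) μ :=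
      (continuousMultilinearCurryLeftEquiv ℝ (fun _ : Fin (k + 1) => E)
        ℝ).continuous.comp_aestronglyMeasurable (hmeas _ hk x)
    obtain ⟨hi, heq⟩ := fderiv_integral_apply_of_dominated
      (G := fun a => iteratedFDeriv ℝ k (F a)) (b := b)
      (fun a => (hF a).differentiable_iteratedFDeriv (by exact_mod_cast hk))
      (hmeas k (by omega)) (hint k (by omega) x) hmeas' hb
      (hle.mono fun a ha y hy => norm_fderiv_iteratedFDeriv.trans_le (ha y hy))
    ext v
    rw [Function.comp_apply, continuousMultilinearCurryLeftEquiv_symm_apply, heq,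
      ContinuousMultilinearMap.integral_apply (hi _),
      ContinuousMultilinearMap.integral_apply (hint _ hk x)]
    simp [iteratedFDeriv_succ_apply_left]

theorem iteratedFDeriv_comp_smul_add {E : Type*} [NormedAddCommGroup E] [NormedSpace ℝ E]
    {k : ℕ} {H : E → ℝ} (hH : ContDiff ℝ k H) (a : ℝ) (b x : E) :
    iteratedFDeriv ℝ k (fun y => H (a • y + b)) x = a ^ k • iteratedFDeriv ℝ k H (a • x + b) := by
  have h1 : ContDiff ℝ k fun y => H (y + b) := hH.comp (contDiff_id.add contDiff_const)
  have := congrFun (iteratedFDeriv_comp_const_smul a h1) x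
  rw [this, iteratedFDeriv_comp_add_right]

theorem integral_abs_rpow_gaussianReal {r : ℝ} (hr : 0 ≤ r) {v : ℝ} (hv : 0 ≤ v) :
    ∫ x, |x| ^ r ∂gaussianReal 0 v.toNNReal = absMoment r (Real.sqrt v) := by
  rcases hv.eq_or_lt with rfl | hv
  · rcases hr.eq_or_lt with rfl | hr
    · have : √π ≠ 0 := Real.sqrt_ne_zero'.2 Real.pi_pos
      rw [absMoment, zero_add, Real.Gamma_one_half_eq]
      simp [this]
    · simp [absMoment, Real.zero_rpow hr.ne']
  have hv' : v.toNNReal ≠ 0 := by simpa using hv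
  rw [integral_gaussianReal_eq_integral_smul hv']
  have hpdf : ∀ x : ℝ, gaussianPDFReal 0 v.toNNReal x • |x| ^ r =
      (√(2 * π * v))⁻¹ * (|x| ^ r * rexp (-(2 * v)⁻¹ * |x| ^ (2 : ℝ))) := by
    intro x
    rw [gaussianPDFReal, Real.coe_toNNReal _ hv.le, smul_eq_mul, sub_zero, Real.rpow_two, sq_abs]
    have : -x ^ 2 / (2 * v) = -(2 * v)⁻¹ * x ^ 2 := by ring
    rw [this]
    ring
  simp_rw [hpdf]
  rw [integral_const_mul,
    integral_comp_abs (f := fun x => x ^ r * rexp (-(2 * v)⁻¹ * x ^ (2 : ℝ))),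
    integral_rpow_mul_exp_neg_mul_rpow two_pos (by linarith) (by positivity), absMoment]
  have h2 : ((2 * v)⁻¹ : ℝ) ^ (-(r + 1) / 2) = 2 ^ (r / 2) * √v ^ r * √(2 * v) := by
    rw [Real.inv_rpow (by positivity), ← Real.rpow_neg (by positivity), Real.sqrt_eq_rpow,
      Real.sqrt_eq_rpow, ← Real.rpow_mul hv.le,
      show -(-(r + 1) / 2) = r / 2 + 1 / 2 by ring, Real.rpow_add (by positivity),
      Real.mul_rpow two_pos.le hv.le]
    congr 3
    ring
  have h3 : √(2 * π * v) = √π * √(2 * v) := by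
    rw [← Real.sqrt_mul Real.pi_pos.le]
    congr 1
    ring
  rw [h2, h3]
  have : √(2 * v) ≠ 0 := Real.sqrt_ne_zero'.2 (by positivity)
  have : √π ≠ 0 := Real.sqrt_ne_zero'.2 Real.pi_pos
  field_simp

theorem abs_mul_add_mul_rpow_le {r a b : ℝ} (hr : 0 ≤ r) (hab : a ^ 2 + b ^ 2 = 1) (x z : ℝ) :
    |a * x + b * z| ^ r ≤ 2 ^ (r / 2) * (|x| ^ r + |z| ^ r) := by
  set M := max |x| |z|
  have hM : 0 ≤ M := (abs_nonneg x).trans (le_max_left _ _)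
  have hx : x ^ 2 ≤ M ^ 2 := sq_le_sq.2 ((le_max_left _ _).trans (le_abs_self M))
  have hz : z ^ 2 ≤ M ^ 2 := sq_le_sq.2 ((le_max_right _ _).trans (le_abs_self M))
  have h1 : |a * x + b * z| ≤ √2 * M := by
    refine abs_le_of_sq_le_sq ?_ (by positivity)
    rw [mul_pow, Real.sq_sqrt zero_le_two]
    nlinarith [sq_nonneg (a * z - b * x)]
  calc |a * x + b * z| ^ r ≤ (√2 * M) ^ r := Real.rpow_le_rpow (abs_nonneg _) h1 hr
    _ = 2 ^ (r / 2) * M ^ r := by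
      rw [Real.mul_rpow (by positivity) hM, Real.sqrt_eq_rpow, ← Real.rpow_mul zero_le_two]
      congr 2
      ring
    _ ≤ 2 ^ (r / 2) * (|x| ^ r + |z| ^ r) := by
      gcongr
      have h2 := Real.rpow_nonneg (abs_nonneg x) r
      have h3 := Real.rpow_nonneg (abs_nonneg z) r
      rcases max_choice |x| |z| with h | h <;> simp only [M, h] <;> linarith

theorem exp_neg_sq_add_sqrt_sq {s : ℝ} (hs : 0 < s) :
    Real.exp (-s) ^ 2 + √(1 - Real.exp (-2 * s)) ^ 2 = 1 := by
  rw [Real.sq_sqrt (by simpa using hs.le), ← Real.exp_nat_mul]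
  push_cast
  ring_nf

theorem IsGaussianVec.map_eval {Ω : Type*} [MeasureSpace Ω] {d : ℕ} {Z : Ω → Fin d → ℝ}
    {S : Matrix (Fin d) (Fin d) ℝ} (hZ : IsGaussianVec Z S) (i : Fin d) :
    Measure.map (fun ω => Z ω i) ℙ = gaussianReal 0 (S i i).toNNReal := by
  simpa [Pi.single_apply] using hZ.2 (Pi.single i 1)

theorem IsGaussianVec.memLp {Ω : Type*} [MeasureSpace Ω] {d : ℕ} {Z : Ω → Fin d → ℝ}
    {S : Matrix (Fin d) (Fin d) ℝ} (hZ : IsGaussianVec Z S) {p : ENNReal} (hp : p ≠ ⊤) :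
    MemLp Z p := by
  rw [memLp_pi_iff]
  intro i
  have hm : Measurable fun ω => Z ω i := (measurable_pi_apply i).comp hZ.1
  have := memLp_id_gaussianReal' (μ := 0) (v := (S i i).toNNReal) p hp
  rw [← hZ.map_eval i] at this
  exact (memLp_map_measure_iff aestronglyMeasurable_id hm.aemeasurable).1 this

theorem IsGaussianVec.integrable_rpow {Ω : Type*} [MeasureSpace Ω]
    [IsProbabilityMeasure (ℙ : Measure Ω)] {d : ℕ} {Z : Ω → Fin d → ℝ}
    {S : Matrix (Fin d) (Fin d) ℝ} (hZ : IsGaussianVec Z S) {q : ℝ} (hq : 0 ≤ q)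
    {c : ℝ} (hc : 0 ≤ c) : Integrable fun ω => (c + ‖Z ω‖) ^ q := by
  have h1 : MemLp (fun ω => c + ‖Z ω‖) (ENNReal.ofReal q) :=
    (memLp_const c).add (hZ.memLp ENNReal.ofReal_ne_top).norm
  have h2 := h1.integrable_norm_rpow'
  rw [ENNReal.toReal_ofReal hq] at h2
  refine h2.congr (.of_forall fun ω => ?_)
  simp only [Real.norm_eq_abs]
  rw [abs_of_nonneg (by positivity)]

theorem IsGaussianVec.integrable_abs_rpow {Ω : Type*} [MeasureSpace Ω]
    [IsProbabilityMeasure (ℙ : Measure Ω)] {d : ℕ} {Z : Ω → Fin d → ℝ}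
    {S : Matrix (Fin d) (Fin d) ℝ} (hZ : IsGaussianVec Z S) {r : ℝ} (hr : 0 ≤ r) (i : Fin d) :
    Integrable fun ω => |Z ω i| ^ r := by
  have hm : Measurable fun ω => Z ω i := (measurable_pi_apply i).comp hZ.1
  refine (hZ.integrable_rpow hr le_rfl).mono'
    (hm.abs.pow_const r).aestronglyMeasurable (.of_forall fun ω => ?_)
  rw [Real.norm_of_nonneg (by positivity), zero_add]
  exact Real.rpow_le_rpow (abs_nonneg _) (norm_le_pi_norm (Z ω) i) hr

theorem IsGaussianVec.integral_abs_rpow {Ω : Type*} [MeasureSpace Ω] {d : ℕ} {Z : Ω → Fin d → ℝ}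
    {S : Matrix (Fin d) (Fin d) ℝ} (hZ : IsGaussianVec Z S) (hS : S.PosSemidef) {r : ℝ}
    (hr : 0 ≤ r) (i : Fin d) : ∫ ω, |Z ω i| ^ r = absMoment r (√(S i i)) := by
  have hm : Measurable fun ω => Z ω i := (measurable_pi_apply i).comp hZ.1
  rw [← integral_abs_rpow_gaussianReal hr hS.diag_nonneg, ← hZ.map_eval i,
    integral_map hm.aemeasurable (by fun_prop)]

theorem norm_ou_le {E : Type*} [NormedAddCommGroup E] [NormedSpace ℝ E] {s : ℝ} (hs : 0 < s)
    (w z : E) : ‖Real.exp (-s) • w + √(1 - Real.exp (-2 * s)) • z‖ ≤ ‖w‖ + ‖z‖ := by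
  have h := exp_neg_sq_add_sqrt_sq hs
  have ha := Real.exp_pos (-s)
  have hb := Real.sqrt_nonneg (1 - Real.exp (-2 * s))
  refine (norm_add_le _ _).trans ?_
  rw [norm_smul, norm_smul, Real.norm_of_nonneg ha.le, Real.norm_of_nonneg hb]
  exact add_le_add (mul_le_of_le_one_left (norm_nonneg _) (by nlinarith))
    (mul_le_of_le_one_left (norm_nonneg _) (by nlinarith))

theorem norm_ou_sub_le {E : Type*} [NormedAddCommGroup E] [NormedSpace ℝ E] {s : ℝ} (hs : 0 < s)
    (w z : E) : ‖Real.exp (-s) • w + √(1 - Real.exp (-2 * s)) • z - z‖ ≤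
      Real.exp (-s) * (‖w‖ + ‖z‖) := by
  have h := exp_neg_sq_add_sqrt_sq hs
  have ha := Real.exp_pos (-s)
  have hb := Real.sqrt_nonneg (1 - Real.exp (-2 * s))
  set a := Real.exp (-s)
  set b := √(1 - Real.exp (-2 * s))
  have hb1 : b ≤ 1 := by nlinarith
  have hab : 1 - b ≤ a := by nlinarith
  rw [show a • w + b • z - z = a • w - (1 - b) • z by module]
  refine (norm_sub_le _ _).trans ?_
  rw [norm_smul, norm_smul, Real.norm_of_nonneg ha.le, Real.norm_of_nonneg (by linarith), mul_add]
  gcongr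

/-- Derivatives of the Stein solution, under polynomial growth of the derivatives of the test
function. -/
theorem iteratedFDeriv_stein_solution {Ω : Type*} [MeasureSpace Ω]
    [IsProbabilityMeasure (ℙ : Measure Ω)] {d t : ℕ} (ht : 1 ≤ t) {S : Matrix (Fin d) (Fin d) ℝ}
    {Z : Ω → Fin d → ℝ} (hZ : IsGaussianVec Z S) {H : (Fin d → ℝ) → ℝ} (hH : ContDiff ℝ t H)
    {C : ℝ} (hC : ∀ x, |H x| ≤ C) {K r : ℝ} (hr : 0 ≤ r) (hK : 0 ≤ K)
    (hgrowth : ∀ k, 1 ≤ k → k ≤ t → ∀ x U, 1 ≤ U → ‖x‖ ≤ U →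
      ‖iteratedFDeriv ℝ k H x‖ ≤ K * U ^ r) (w : Fin d → ℝ) :
    Integrable (fun p => Real.exp (-p.1) ^ t • iteratedFDeriv ℝ t H
        (Real.exp (-p.1) • w + √(1 - Real.exp (-2 * p.1)) • Z p.2))
      ((volume.restrict (Set.Ioi (0 : ℝ))).prod (ℙ : Measure Ω)) ∧
    iteratedFDeriv ℝ t (fun w => ∫ s in Set.Ioi (0 : ℝ),
      ((∫ ω, H (fun j => Real.exp (-s) * w j + √(1 - Real.exp (-2 * s)) * Z ω j))
        - ∫ ω, H (Z ω))) w =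
      ∫ p, Real.exp (-p.1) ^ t • iteratedFDeriv ℝ t H
          (Real.exp (-p.1) • w + √(1 - Real.exp (-2 * p.1)) • Z p.2)
        ∂(volume.restrict (Set.Ioi (0 : ℝ))).prod (ℙ : Measure Ω) := by
  set μ := (volume.restrict (Set.Ioi (0 : ℝ))).prod (ℙ : Measure Ω)
  set X : ℝ × Ω → (Fin d → ℝ) → Fin d → ℝ :=
    fun p w => Real.exp (-p.1) • w + √(1 - Real.exp (-2 * p.1)) • Z p.2 with hX
  have hXm : ∀ w, Measurable fun p => X p w := by
    intro w
    have := hZ.1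
    fun_prop
  set F : ℝ × Ω → (Fin d → ℝ) → ℝ := fun p w => H (X p w) - H (Z p.2) with hF
  have hHX : ∀ p, ContDiff ℝ t fun w => H (X p w) := fun p => by
    refine hH.comp ?_
    fun_prop
  have hFc : ∀ p, ContDiff ℝ t (F p) := fun p => (hHX p).sub contDiff_const
  have hFD : ∀ k, 1 ≤ k → k ≤ t → ∀ p w, iteratedFDeriv ℝ k (F p) w =
      Real.exp (-p.1) ^ k • iteratedFDeriv ℝ k H (X p w) := by
    intro k hk hkt p w
    have hle : (k : WithTop ℕ∞) ≤ t := by exact_mod_cast hkt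
    rw [← iteratedFDeriv_comp_smul_add (hH.of_le hle), hF]
    rw [fun_iteratedFDeriv_sub_apply ((hHX p).of_le hle).contDiffAt contDiffAt_const,
      iteratedFDeriv_const_of_ne (by omega)]
    simp [hX]
  have hpos : ∀ᵐ p ∂μ, 0 < p.1 :=
    (Measure.quasiMeasurePreserving_fst (μ := volume.restrict (Set.Ioi (0 : ℝ)))
      (ν := (ℙ : Measure Ω))).ae (ae_restrict_mem measurableSet_Ioi)
  have hdom : ∀ R : ℝ, 0 ≤ R →
      Integrable (fun p : ℝ × Ω => K * (Real.exp (-p.1) * (1 + R + ‖Z p.2‖) ^ (r + 1))) μ := by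
    intro R hR
    have h1 : Integrable (fun s : ℝ => Real.exp (-s)) (volume.restrict (Set.Ioi 0)) := by
      simpa [IntegrableOn] using exp_neg_integrableOn_Ioi 0 one_pos
    exact (h1.mul_prod (hZ.integrable_rpow (by linarith) (by linarith))).const_mul K
  have hbound : ∀ k ≤ t, ∀ R : ℝ, ∃ b : ℝ × Ω → ℝ, Integrable b μ ∧
      ∀ᵐ p ∂μ, ∀ x, ‖x‖ ≤ R → ‖iteratedFDeriv ℝ k (F p) x‖ ≤ b p := by
    intro k hkt R
    refine ⟨_, hdom |R| (abs_nonneg R), hpos.mono fun p hp x hx => ?_⟩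
    set U := 1 + |R| + ‖Z p.2‖ with hU
    have hxR : ‖x‖ ≤ |R| := hx.trans (le_abs_self R)
    have hU1 : 1 ≤ U := by
      have := norm_nonneg (Z p.2)
      have := abs_nonneg R
      linarith
    have hU0 : 0 < U := by linarith
    have hXU : ‖X p x‖ ≤ U := by
      have := norm_ou_le hp x (Z p.2)
      linarith
    have hexp := Real.exp_pos (-p.1)
    rcases Nat.eq_zero_or_pos k with rfl | hk
    · have hmv : ‖H (X p x) - H (Z p.2)‖ ≤ K * U ^ r * ‖X p x - Z p.2‖ := by
        refine (convex_closedBall (0 : Fin d → ℝ) U).norm_image_sub_le_of_norm_fderiv_le (𝕜 := ℝ)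
          (fun y _ => hH.differentiable (by exact_mod_cast (by omega : t ≠ 0)) y) (fun y hy => ?_)
          ?_ ?_
        · rw [← norm_iteratedFDeriv_one]
          exact hgrowth 1 le_rfl ht y U hU1 (by simpa using hy)
        · simp only [mem_closedBall_zero_iff]
          have := abs_nonneg R
          linarith
        · simpa using hXU
      rw [norm_iteratedFDeriv_zero]
      calc ‖F p x‖ ≤ K * U ^ r * ‖X p x - Z p.2‖ := hmv
        _ ≤ K * U ^ r * (Real.exp (-p.1) * U) := by
          gcongr
          refine (norm_ou_sub_le hp x (Z p.2)).trans ?_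
          gcongr
          linarith
        _ = K * (Real.exp (-p.1) * U ^ (r + 1)) := by
          rw [Real.rpow_add_one hU0.ne']
          ring
    · rw [hFD k hk hkt, norm_smul, Real.norm_of_nonneg (by positivity)]
      calc Real.exp (-p.1) ^ k * ‖iteratedFDeriv ℝ k H (X p x)‖
          ≤ Real.exp (-p.1) * (K * U ^ (r + 1)) := by
            gcongr
            · exact pow_le_of_le_one hexp.le (by simpa using hp.le) (by omega)
            · refine (hgrowth k hk hkt _ U hU1 hXU).trans ?_
              gcongr
              linarith
        _ = K * (Real.exp (-p.1) * U ^ (r + 1)) := by ring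
  have hmeas : ∀ k ≤ t, ∀ x, AEStronglyMeasurable (fun p => iteratedFDeriv ℝ k (F p) x) μ := by
    intro k hkt x
    rcases Nat.eq_zero_or_pos k with rfl | hk
    · have h0 : ∀ p, iteratedFDeriv ℝ 0 (F p) x =
          (continuousMultilinearCurryFin0 ℝ (Fin d → ℝ) ℝ).symm (F p x) := fun p => rfl
      simp_rw [h0]
      refine (LinearIsometryEquiv.continuous _).comp_aestronglyMeasurable ?_
      have := hH.continuous.measurable
      exact ((this.comp (hXm x)).sub
        (this.comp (hZ.1.comp measurable_snd))).aestronglyMeasurable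
    · simp_rw [hFD k hk hkt]
      have hexp : Measurable fun p : ℝ × Ω => Real.exp (-p.1) ^ k := by fun_prop
      exact hexp.aestronglyMeasurable.smul
        ((hH.continuous_iteratedFDeriv (by exact_mod_cast hkt)).comp_stronglyMeasurable
          (hXm x).stronglyMeasurable).aestronglyMeasurable
  have hfun : (fun w => ∫ s in Set.Ioi (0 : ℝ),
      ((∫ ω, H (fun j => Real.exp (-s) * w j + √(1 - Real.exp (-2 * s)) * Z ω j))
        - ∫ ω, H (Z ω))) = fun w => ∫ p, F p w ∂μ := by
    ext w
    have hFint : Integrable (fun p => F p w) μ := by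
      obtain ⟨b, hb, hle⟩ := hbound 0 (Nat.zero_le t) ‖w‖
      have := hH.continuous.measurable
      refine hb.mono' ((this.comp (hXm w)).sub
        (this.comp (hZ.1.comp measurable_snd))).aestronglyMeasurable (hle.mono fun p hp => ?_)
      simpa using hp w le_rfl
    rw [integral_prod _ hFint]
    refine integral_congr_ae (.of_forall fun s => ?_)
    have hb : ∀ Y : Ω → Fin d → ℝ, Measurable Y → Integrable fun ω => H (Y ω) := fun Y hY =>
      Integrable.of_bound (hH.continuous.measurable.comp hY).aestronglyMeasurable C
        (.of_forall fun ω => hC _)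
    exact (integral_sub (hb _ ((hXm w).comp measurable_prodMk_left)) (hb Z hZ.1)).symm
  have hint : Integrable (fun p => iteratedFDeriv ℝ t (F p) w) μ := by
    obtain ⟨b, hb, hle⟩ := hbound t le_rfl ‖w‖
    exact hb.mono' (hmeas t le_rfl w) (hle.mono fun p hp => hp w le_rfl)
  rw [hfun, iteratedFDeriv_integral_of_dominated hFc hmeas hbound le_rfl]
  simp_rw [hFD t ht le_rfl, hX] at hint ⊢
  exact ⟨hint, trivial⟩

theorem abs_pderiv_comp_le_of_classCPmulti {d m t : ℕ} {P : (Fin d → ℝ) → ℝ}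
    (hP : ∀ x, 0 ≤ P x) {g : (Fin d → ℝ) → Fin m → ℝ} (hg : ClassCPmulti d m t P g)
    {h : (Fin m → ℝ) → ℝ} (hh : CbP m t h) {k : ℕ} (hk : 1 ≤ k) (hkt : k ≤ t) (x : Fin d → ℝ)
    (idx : Fin k → Fin d) :
    |pderiv' k (fun v => h (g v)) x idx| ≤ hpm m k h * P x ^ ((k : ℝ) / t) := by
  have hle : (k : WithTop ℕ∞) ≤ t := by exact_mod_cast hkt
  have ht : (0 : ℝ) < t := by exact_mod_cast (by omega : 0 < t)
  have hpow : ∀ j : ℕ, (P x ^ (1 / (t : ℝ))) ^ j = P x ^ ((j : ℝ) / t) := by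
    intro j
    rw [← Real.rpow_natCast, ← Real.rpow_mul (hP x)]
    congr 1
    ring
  rw [← hpow]
  refine abs_pderiv_comp_le hk ⟨hh.1.of_le hle, fun j hj => hh.2 j (hj.trans hkt)⟩
    (hg.1.of_le hle) (fun j hj hjk l idx => ?_) idx
  have hj0 : (0 : ℝ) < j := by exact_mod_cast hj
  rw [hpow]
  have := Real.rpow_le_rpow (by positivity) (hg.2 j hj (hjk.trans hkt) l x idx)
    (by positivity : 0 ≤ (j : ℝ) / t)
  rwa [← Real.rpow_mul (abs_nonneg _), div_mul_div_cancel₀ hj0.ne', div_self ht.ne',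
    Real.rpow_one] at this

theorem exists_norm_iteratedFDeriv_comp_le {d m t : ℕ} {A B r : ℝ} (hA : 0 ≤ A) (hB : 0 ≤ B)
    (hr : 0 ≤ r) {g : (Fin d → ℝ) → Fin m → ℝ}
    (hg : ClassCPmulti d m t (fun w => A + B * ∑ i, |w i| ^ r) g)
    {h : (Fin m → ℝ) → ℝ} (hh : CbP m t h) :
    ∃ K, 0 ≤ K ∧ ∀ k, 1 ≤ k → k ≤ t → ∀ (x : Fin d → ℝ) (U : ℝ), 1 ≤ U → ‖x‖ ≤ U →
      ‖iteratedFDeriv ℝ k (fun v => h (g v)) x‖ ≤ K * U ^ r := by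
  have hterm : ∀ k, 0 ≤ (d : ℝ) ^ k * hpm m k h := fun k =>
    mul_nonneg (by positivity) (hpm_nonneg m k h)
  refine ⟨(∑ k ∈ Finset.range (t + 1), (d : ℝ) ^ k * hpm m k h) * (1 + A + B * d),
    mul_nonneg (Finset.sum_nonneg fun k _ => hterm k) (by positivity), ?_⟩
  intro k hk hkt x U hU hx
  have hUr : 1 ≤ U ^ r := Real.one_le_rpow hU hr
  have hP : 0 ≤ A + B * ∑ i, |x i| ^ r := by positivity
  have hsum : ∑ i, |x i| ^ r ≤ d * U ^ r := by
    calc ∑ i, |x i| ^ r ≤ ∑ _i : Fin d, U ^ r := Finset.sum_le_sum fun i _ =>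
          Real.rpow_le_rpow (abs_nonneg _) ((norm_le_pi_norm x i).trans hx) hr
      _ = d * U ^ r := by simp
  have hkt' : (k : ℝ) / t ≤ 1 := div_le_one_of_le₀ (by exact_mod_cast hkt) (by positivity)
  have hPk : (A + B * ∑ i, |x i| ^ r) ^ ((k : ℝ) / t) ≤ (1 + A + B * d) * U ^ r := by
    calc (A + B * ∑ i, |x i| ^ r) ^ ((k : ℝ) / t)
        ≤ (1 + (A + B * ∑ i, |x i| ^ r)) ^ ((k : ℝ) / t) :=
          Real.rpow_le_rpow hP (by linarith) (by positivity)
      _ ≤ 1 + (A + B * ∑ i, |x i| ^ r) := Real.rpow_le_self_of_one_le (by linarith) hkt'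
      _ ≤ 1 * U ^ r + (A * U ^ r + B * (d * U ^ r)) := by
        gcongr
        · linarith
        · exact le_mul_of_one_le_right hA hUr
      _ = (1 + A + B * d) * U ^ r := by ring
  calc ‖iteratedFDeriv ℝ k (fun v => h (g v)) x‖
      ≤ ∑ l : Fin k → Fin d, |pderiv' k (fun v => h (g v)) x l| :=
        norm_iteratedFDeriv_le_sum_pderiv _ _
    _ ≤ ∑ _l : Fin k → Fin d, hpm m k h * ((1 + A + B * d) * U ^ r) := by
        refine Finset.sum_le_sum fun l _ => ?_
        refine
          (abs_pderiv_comp_le_of_classCPmulti (fun x => by positivity) hg hh hk hkt x l).trans ?_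
        exact mul_le_mul_of_nonneg_left hPk (hpm_nonneg m k h)
    _ = (d : ℝ) ^ k * hpm m k h * ((1 + A + B * d) * U ^ r) := by
        simp
        ring
    _ ≤ (∑ k ∈ Finset.range (t + 1), (d : ℝ) ^ k * hpm m k h) * ((1 + A + B * d) * U ^ r) := by
        gcongr
        exact Finset.single_le_sum (f := fun k => (d : ℝ) ^ k * hpm m k h)
          (fun k _ => hterm k) (Finset.mem_range.2 (by omega))
    _ = _ := by ring

/-- Lemma 4.2(i) of the paper (inequality (4.5)/Proposition 2.1 of Gaunt–Sutcliffe): bound on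
the `t`-th order partial derivatives of the solution of the multivariate normal Stein
equation with test function `h ∘ g`. -/
theorem stein_solution_partial_deriv_bound
    {Ω : Type*} [MeasureSpace Ω] [IsProbabilityMeasure (ℙ : Measure Ω)]
    (d m t : ℕ) (ht : 1 ≤ t)
    (S : Matrix (Fin d) (Fin d) ℝ) (hSpsd : S.PosSemidef)
    (Z : Ω → Fin d → ℝ) (hZ : IsGaussianVec Z S)
    (A B r : ℝ) (hA : 0 ≤ A) (hB : 0 ≤ B) (hr : 0 ≤ r)
    (g : (Fin d → ℝ) → Fin m → ℝ)
    (hg : ClassCPmulti d m t (fun w => A + B * ∑ i, |w i| ^ r) g)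
    (h : (Fin m → ℝ) → ℝ) (hh : CbP m t h)
    (f : (Fin d → ℝ) → ℝ)
    (hf : ∀ w, f w = -∫ s in Set.Ioi (0 : ℝ),
        ((∫ ω, h (g (fun j =>
            Real.exp (-s) * w j + Real.sqrt (1 - Real.exp (-2 * s)) * Z ω j)))
          - ∫ ω, h (g (Z ω))))
    (w : Fin d → ℝ) (idx : Fin t → Fin d) :
    |pderiv' t f w idx| ≤
      (hpm m t h / t) *
        (A + ∑ i, 2 ^ (r / 2) * B * (|w i| ^ r + absMoment r (Real.sqrt (S i i)))) := by
  set H : (Fin d → ℝ) → ℝ := fun v => h (g v)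
  have ht0 : (0 : ℝ) < t := by exact_mod_cast ht
  have hH : ContDiff ℝ t H := hh.1.comp hg.1
  obtain ⟨C, hC⟩ := hh.2 0 (Nat.zero_le t)
  have hHC : ∀ x, |H x| ≤ C := fun x => by simpa [pderiv'] using hC (g x) Fin.elim0
  obtain ⟨K, hK, hgrowth⟩ := exists_norm_iteratedFDeriv_comp_le hA hB hr hg hh
  obtain ⟨hint, hderiv⟩ := iteratedFDeriv_stein_solution ht hZ hH hHC hr hK hgrowth w
  have hfneg : f = -fun w => ∫ s in Set.Ioi (0 : ℝ),
      ((∫ ω, H (fun j => Real.exp (-s) * w j + √(1 - Real.exp (-2 * s)) * Z ω j))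
        - ∫ ω, H (Z ω)) := funext hf
  set μ := (volume.restrict (Set.Ioi (0 : ℝ))).prod (ℙ : Measure Ω)
  have hpos : ∀ᵐ p ∂μ, 0 < p.1 :=
    (Measure.quasiMeasurePreserving_fst (μ := volume.restrict (Set.Ioi (0 : ℝ)))
      (ν := (ℙ : Measure Ω))).ae (ae_restrict_mem measurableSet_Ioi)
  set G : Ω → ℝ := fun ω => A + ∑ i, 2 ^ (r / 2) * B * (|w i| ^ r + |Z ω i| ^ r)
  have hterm : ∀ i, Integrable fun ω => 2 ^ (r / 2) * B * (|w i| ^ r + |Z ω i| ^ r) := fun i =>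
    ((integrable_const _).add (hZ.integrable_abs_rpow hr i)).const_mul _
  have hGint : Integrable G :=
    (integrable_const A).add (integrable_finsetSum _ fun i _ => hterm i)
  have hG : ∫ ω, G ω =
      A + ∑ i, 2 ^ (r / 2) * B * (|w i| ^ r + absMoment r (Real.sqrt (S i i))) := by
    rw [integral_add (integrable_const A) (integrable_finsetSum _ fun i _ => hterm i),
      integral_finsetSum _ fun i _ => hterm i]
    congr 1
    · simp
    · refine Finset.sum_congr rfl fun i _ => ?_
      rw [integral_const_mul, integral_add (integrable_const _) (hZ.integrable_abs_rpow hr i),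
        hZ.integral_abs_rpow hSpsd hr i]
      simp
  have hexpint : Integrable (fun s : ℝ => Real.exp (-t * s)) (volume.restrict (Set.Ioi 0)) :=
    exp_neg_integrableOn_Ioi 0 ht0
  have hexp : ∫ s in Set.Ioi (0 : ℝ), Real.exp (-t * s) = 1 / t := by
    rw [integral_exp_mul_Ioi (by linarith) 0]
    simp
  have hpoint : ∀ᵐ p ∂μ, ‖(Real.exp (-p.1) ^ t • iteratedFDeriv ℝ t H
      (Real.exp (-p.1) • w + √(1 - Real.exp (-2 * p.1)) • Z p.2)) fun j => Pi.single (idx j) 1‖ ≤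
      hpm m t h * (Real.exp (-t * p.1) * G p.2) := by
    filter_upwards [hpos] with p hp
    set x := Real.exp (-p.1) • w + √(1 - Real.exp (-2 * p.1)) • Z p.2
    have hle := abs_pderiv_comp_le_of_classCPmulti (fun x => by positivity) hg hh ht le_rfl x idx
    rw [div_self ht0.ne', Real.rpow_one] at hle
    have hPG : A + B * ∑ i, |x i| ^ r ≤ G p.2 := by
      rw [Finset.mul_sum]
      refine add_le_add le_rfl (Finset.sum_le_sum fun i _ => ?_)
      have := abs_mul_add_mul_rpow_le hr (exp_neg_sq_add_sqrt_sq hp) (w i) (Z p.2 i)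
      calc B * |x i| ^ r ≤ B * (2 ^ (r / 2) * (|w i| ^ r + |Z p.2 i| ^ r)) := by
            gcongr
            simpa [x] using this
        _ = 2 ^ (r / 2) * B * (|w i| ^ r + |Z p.2 i| ^ r) := by ring
    rw [smul_apply, norm_smul, Real.norm_of_nonneg (by positivity)]
    calc Real.exp (-p.1) ^ t * ‖iteratedFDeriv ℝ t H x fun j => Pi.single (idx j) 1‖
        ≤ Real.exp (-p.1) ^ t * (hpm m t h * G p.2) := by
          gcongr
          exact hle.trans (mul_le_mul_of_nonneg_left hPG (hpm_nonneg m t h))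
      _ = hpm m t h * (Real.exp (-t * p.1) * G p.2) := by
          rw [← Real.exp_nat_mul, show (t : ℝ) * -p.1 = -t * p.1 by ring]
          ring
  rw [pderiv', hfneg, iteratedFDeriv_neg_apply, neg_apply, abs_neg, hderiv,
    ContinuousMultilinearMap.integral_apply hint]
  refine (norm_integral_le_of_norm_le
    ((hexpint.mul_prod hGint).const_mul (hpm m t h)) hpoint).trans_eq ?_
  rw [integral_const_mul, integral_prod_mul (fun s => Real.exp (-t * s)) G, hexp, hG]
  ring
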